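/- Let k ≥ 2 be an integer and let (W_m)_{m≥1} be a sequence of random variables on a probability space with W_m > 0 almost surely, such that for every real γ > −1, W_m^γ is integrable for all m and E[W_m^γ] → (1+γ)^{−(k−1)/2} as m → ∞. Then the laws of −2 log W_m converge weakly (in distribution) to the chi-squared distribution with k−1 degrees of freedom, i.e., the Gamma distribution with shape (k−1)/2 and rate 1/2. -/

import Mathlib

open MeasureTheory ProbabilityTheory Filter Topology BoundedContinuousFunction

/-- If `ν n → ν₀` weakly and the second moments of a nonnegative continuous function `g` are
bounded along the sequence, then `g` is square integrable for the limit. -/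
lemma integrable_sq_of_tendsto_probabilityMeasure {E : Type*} [MeasurableSpace E]
    [TopologicalSpace E] [BorelSpace E] [HasOuterApproxClosed E]
    {ν : ℕ → ProbabilityMeasure E} {ν₀ : ProbabilityMeasure E} (hν : Tendsto ν atTop (𝓝 ν₀))
    {g : E → ℝ} (hg : Continuous g) {C : ℝ}
    (hint : ∀ n, Integrable (fun x ↦ g x ^ 2) (ν n : Measure E))
    (hC : ∀ n, ∫ x, g x ^ 2 ∂(ν n : Measure E) ≤ C) :
    Integrable (fun x ↦ g x ^ 2) (ν₀ : Measure E) ∧ ∫ x, g x ^ 2 ∂(ν₀ : Measure E) ≤ C := by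
  have hC0 : 0 ≤ C := (integral_nonneg fun x ↦ sq_nonneg (g x)).trans (hC 0)
  have key : ∫⁻ x, ENNReal.ofReal (g x ^ 2) ∂(ν₀ : Measure E) ≤ ENNReal.ofReal C := by
    refine (lintegral_le_liminf_lintegral_of_forall_isOpen_measure_le_liminf_measure
      (μs := fun n ↦ (ν n : Measure E)) (f := fun x ↦ g x ^ 2) (hg.pow 2) (fun x ↦ sq_nonneg (g x))
      fun G hG ↦ ProbabilityMeasure.le_liminf_measure_open_of_tendsto hν hG).trans ?_
    refine (liminf_le_liminf (v := fun _ ↦ ENNReal.ofReal C)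
      (Eventually.of_forall fun n ↦ ?_)).trans_eq (liminf_const _)
    rw [← ofReal_integral_eq_lintegral_ofReal (hint n) (ae_of_all _ fun x ↦ sq_nonneg (g x))]
    exact ENNReal.ofReal_le_ofReal (hC n)
  have hi : Integrable (fun x ↦ g x ^ 2) (ν₀ : Measure E) :=
    (lintegral_ofReal_ne_top_iff_integrable (hg.pow 2).aestronglyMeasurable
      (ae_of_all _ fun x ↦ sq_nonneg (g x))).1 (ne_top_of_le_ne_top ENNReal.ofReal_ne_top key)
  refine ⟨hi, ?_⟩
  rwa [← ofReal_integral_eq_lintegral_ofReal hi (ae_of_all _ fun x ↦ sq_nonneg (g x)),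
    ENNReal.ofReal_le_ofReal_iff hC0] at key

lemma abs_integral_sub_integral_min_le {E : Type*} [MeasurableSpace E] {ν : Measure E}
    [IsProbabilityMeasure ν] {g : E → ℝ} (hg : Measurable g) {C R : ℝ}
    (hR : 0 < R) (hint : Integrable (fun x ↦ g x ^ 2) ν) (hC : ∫ x, g x ^ 2 ∂ν ≤ C) :
    |∫ x, g x ∂ν - ∫ x, min (g x) R ∂ν| ≤ C / R := by
  have hg1 : Integrable g ν :=
    ((memLp_two_iff_integrable_sq hg.aestronglyMeasurable).2 hint).integrable one_le_two
  have hmin : Integrable (fun x ↦ min (g x) R) ν := hg1.inf (integrable_const R)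
  rw [← integral_sub hg1 hmin, abs_of_nonneg (integral_nonneg fun x ↦ by simp)]
  calc ∫ x, g x - min (g x) R ∂ν ≤ ∫ x, g x ^ 2 / R ∂ν := by
        refine integral_mono (hg1.sub hmin) (hint.div_const R) fun x ↦ ?_
        simp only
        rw [le_div_iff₀ hR]
        rcases le_total (g x) R with h | h
        · rw [min_eq_left h]; nlinarith [sq_nonneg (g x)]
        · rw [min_eq_right h]; nlinarith
    _ = (∫ x, g x ^ 2 ∂ν) / R := integral_div _ _
    _ ≤ C / R := by gcongr

/-- If `ν n → ν₀` weakly and the second moments of a nonnegative continuous function `g` are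
bounded along the sequence, then the integrals of `g` converge. -/
lemma tendsto_integral_of_integral_sq_le {E : Type*} [MeasurableSpace E]
    [TopologicalSpace E] [BorelSpace E] [HasOuterApproxClosed E]
    {ν : ℕ → ProbabilityMeasure E} {ν₀ : ProbabilityMeasure E} (hν : Tendsto ν atTop (𝓝 ν₀))
    {g : E → ℝ} (hg : Continuous g) (hg0 : ∀ x, 0 ≤ g x) {C : ℝ}
    (hint : ∀ n, Integrable (fun x ↦ g x ^ 2) (ν n : Measure E))
    (hC : ∀ n, ∫ x, g x ^ 2 ∂(ν n : Measure E) ≤ C) :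
    Tendsto (fun n ↦ ∫ x, g x ∂(ν n : Measure E)) atTop (𝓝 (∫ x, g x ∂(ν₀ : Measure E))) := by
  have hC0 : 0 ≤ C := (integral_nonneg fun x ↦ sq_nonneg (g x)).trans (hC 0)
  obtain ⟨hint₀, hC₀⟩ := integrable_sq_of_tendsto_probabilityMeasure hν hg hint hC
  rw [Metric.tendsto_atTop]
  intro ε hε
  obtain ⟨R, hR, hRε⟩ : ∃ R : ℝ, 0 < R ∧ C / R < ε / 3 := by
    refine ⟨3 * (C + 1) / ε, by positivity, ?_⟩
    rw [div_lt_iff₀ (by positivity)]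
    field_simp
    linarith
  let h : E →ᵇ ℝ := BoundedContinuousFunction.ofNormedAddCommGroup (fun x ↦ min (g x) R)
    (hg.min continuous_const) R fun x ↦ by
      rw [Real.norm_of_nonneg (le_min (hg0 x) hR.le)]
      exact min_le_right _ _
  obtain ⟨N, hN⟩ := Metric.tendsto_atTop.1
    (ProbabilityMeasure.tendsto_iff_forall_integral_tendsto.1 hν h) (ε / 3) (by positivity)
  refine ⟨N, fun n hn ↦ ?_⟩
  have h₁ := hN n hn
  have h₂ := abs_integral_sub_integral_min_le hg.measurable hR (hint n) (hC n)
  have h₃ := abs_integral_sub_integral_min_le hg.measurable hR hint₀ hC₀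
  rw [Real.dist_eq] at h₁ ⊢
  simp only [h, BoundedContinuousFunction.coe_ofNormedAddCommGroup] at h₁
  rw [abs_lt] at h₁ ⊢
  rw [abs_le] at h₂ h₃
  constructor <;> linarith [h₁.1, h₁.2, h₂.1, h₂.2, h₃.1, h₃.2]

/-- Two finite measures on `ℝ` whose moment-generating functions exist and coincide near `0`
are equal. -/
lemma ext_of_mgf_eqOn {ν ν' : Measure ℝ} [IsFiniteMeasure ν] [IsFiniteMeasure ν'] {δ : ℝ}
    (hδ : 0 < δ) (hν : Set.Ioo (-δ) δ ⊆ integrableExpSet id ν)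
    (hν' : Set.Ioo (-δ) δ ⊆ integrableExpSet id ν')
    (h : Set.EqOn (mgf id ν) (mgf id ν') (Set.Ioo (-δ) δ)) : ν = ν' := by
  have analytic {ρ : Measure ℝ} (hρ : Set.Ioo (-δ) δ ⊆ integrableExpSet id ρ) :
      AnalyticOnNhd ℂ (complexMGF id ρ) {z : ℂ | z.re ∈ Set.Ioo (-δ) δ} :=
    analyticOnNhd_complexMGF.mono fun z hz ↦ interior_maximal hρ isOpen_Ioo hz
  have hcont : Tendsto ((↑) : ℝ → ℂ) (𝓝[≠] 0) (𝓝[≠] ((0 : ℝ) : ℂ)) :=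
    Complex.continuous_ofReal.continuousWithinAt.tendsto_nhdsWithin fun x hx ↦ by simpa using hx
  have hfreq : ∃ᶠ z in 𝓝[≠] ((0 : ℝ) : ℂ), complexMGF id ν z = complexMGF id ν' z := by
    refine hcont.frequently (Eventually.frequently ?_)
    filter_upwards [nhdsWithin_le_nhds (Ioo_mem_nhds (neg_lt_zero.2 hδ) hδ)] with x hx
    rw [complexMGF_ofReal, complexMGF_ofReal, h hx]
  have heq := (analytic hν).eqOn_of_preconnected_of_frequently_eq (analytic hν')
    ((convex_Ioo (-δ) δ).linear_preimage Complex.reLm).isPreconnected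
    (by simp [hδ]) hfreq
  refine Measure.ext_of_charFun (funext fun t ↦ ?_)
  rw [← complexMGF_id_mul_I, ← complexMGF_id_mul_I]
  exact heq (by simp [hδ])

/-- A sequence of probability measures on `ℝ` whose moment-generating functions are bounded at
`s` and `-s`, for some `s > 0`, is tight. -/
lemma isTightMeasureSet_of_mgf_le {ν : ℕ → Measure ℝ} [∀ n, IsProbabilityMeasure (ν n)] {s C : ℝ}
    (hs : 0 < s) (hint : ∀ n, s ∈ integrableExpSet id (ν n))
    (hint' : ∀ n, -s ∈ integrableExpSet id (ν n))
    (hC : ∀ n, mgf id (ν n) s ≤ C) (hC' : ∀ n, mgf id (ν n) (-s) ≤ C) :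
    IsTightMeasureSet {ν n | n} := by
  refine isTightMeasureSet_of_tendsto_measure_norm_gt ?_
  have hlim : Tendsto (fun r : ℝ ↦ ENNReal.ofReal (2 * (Real.exp (-s * r) * C))) atTop (𝓝 0) := by
    rw [← ENNReal.ofReal_zero]
    refine ENNReal.tendsto_ofReal ?_
    have : Tendsto (fun r : ℝ ↦ Real.exp (-s * r)) atTop (𝓝 0) :=
      Real.tendsto_exp_atBot.comp (tendsto_id.const_mul_atTop_of_neg (neg_lt_zero.2 hs))
    simpa using (this.mul_const C).const_mul 2
  refine tendsto_of_tendsto_of_tendsto_of_le_of_le tendsto_const_nhds hlim (fun _ ↦ zero_le)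
    fun r ↦ iSup₂_le ?_
  rintro _ ⟨n, rfl⟩
  rw [← ofReal_measureReal]
  refine ENNReal.ofReal_le_ofReal ?_
  have h₁ := measure_ge_le_exp_mul_mgf r hs.le (hint n)
  have h₂ := measure_le_le_exp_mul_mgf (-r) (neg_nonpos.2 hs.le) (hint' n)
  rw [neg_mul_neg] at h₂
  calc (ν n).real {x | r < ‖x‖}
      ≤ (ν n).real ({x | r ≤ id x} ∪ {x | id x ≤ -r}) := by
        refine measureReal_mono fun x (hx : r < |x|) ↦ ?_
        rcases lt_abs.1 hx with h | h
        · exact Or.inl h.le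
        · exact Or.inr (by simp only [id, Set.mem_ofPred_eq]; linarith)
    _ ≤ (ν n).real {x | r ≤ id x} + (ν n).real {x | id x ≤ -r} := measureReal_union_le _ _
    _ ≤ Real.exp (-s * r) * C + Real.exp (-s * r) * C := by
        refine add_le_add (h₁.trans ?_) (h₂.trans ?_)
        · gcongr; exact hC n
        · gcongr; exact hC' n
    _ = 2 * (Real.exp (-s * r) * C) := by ring

/-- **Curtiss theorem**: if the moment-generating functions of a sequence of probability measures
converge on a neighborhood of `0` to that of a probability measure, then the measures converge
weakly. -/
theorem tendsto_of_tendsto_mgf {ν : ℕ → ProbabilityMeasure ℝ} {ν₀ : ProbabilityMeasure ℝ} {δ : ℝ}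
    (hδ : 0 < δ) (hν : ∀ n, Set.Ioo (-δ) δ ⊆ integrableExpSet id (ν n : Measure ℝ))
    (hν₀ : Set.Ioo (-δ) δ ⊆ integrableExpSet id (ν₀ : Measure ℝ))
    (h : ∀ t ∈ Set.Ioo (-δ) δ,
      Tendsto (fun n ↦ mgf id (ν n : Measure ℝ) t) atTop (𝓝 (mgf id (ν₀ : Measure ℝ) t))) :
    Tendsto ν atTop (𝓝 ν₀) := by
  have hs : δ / 2 ∈ Set.Ioo (-δ) δ := ⟨by linarith, by linarith⟩
  have hs' : -(δ / 2) ∈ Set.Ioo (-δ) δ := ⟨by linarith, by linarith⟩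
  obtain ⟨C, hC⟩ := (h _ hs).bddAbove_range
  obtain ⟨C', hC'⟩ := (h _ hs').bddAbove_range
  rw [mem_upperBounds, Set.forall_mem_range] at hC hC'
  have htight : IsTightMeasureSet {(ν n : Measure ℝ) | n} :=
    isTightMeasureSet_of_mgf_le (half_pos hδ) (fun n ↦ hν n hs) (fun n ↦ hν n hs')
      (fun n ↦ (hC n).trans (le_max_left C C')) fun n ↦ (hC' n).trans (le_max_right C C')
  have hcompact : IsCompact (closure {ν n | n}) :=
    isCompact_closure_of_isTightMeasureSet (by simpa using htight)
  refine tendsto_of_subseq_tendsto fun ns hns ↦ ?_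
  obtain ⟨ν', -, φ, hφ, hlim⟩ :=
    hcompact.tendsto_subseq fun n ↦ subset_closure (Set.mem_range_self (f := ν) (ns n))
  refine ⟨φ, ?_⟩
  suffices ν' = ν₀ by rw [← this]; exact hlim
  have hsub : Tendsto (fun n ↦ ns (φ n)) atTop atTop := hns.comp hφ.tendsto_atTop
  have hsq (t x : ℝ) : Real.exp (t * x) ^ 2 = Real.exp (2 * t * x) := by
    rw [← Real.exp_nat_mul]; congr 1; push_cast; ring
  have moment {t : ℝ} (ht : t ∈ Set.Ioo (-(δ / 2)) (δ / 2)) :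
      t ∈ integrableExpSet id (ν' : Measure ℝ) ∧
        mgf id (ν' : Measure ℝ) t = mgf id (ν₀ : Measure ℝ) t := by
    have ht₂ : 2 * t ∈ Set.Ioo (-δ) δ := ⟨by linarith [ht.1], by linarith [ht.2]⟩
    have ht₁ : t ∈ Set.Ioo (-δ) δ := ⟨by linarith [ht.1], by linarith [ht.2]⟩
    have hcont : Continuous fun x : ℝ ↦ Real.exp (t * x) := by fun_prop
    obtain ⟨D, hD⟩ := (h _ ht₂).bddAbove_range
    rw [mem_upperBounds, Set.forall_mem_range] at hD
    have hint (n) : Integrable (fun x ↦ Real.exp (t * x) ^ 2) (ν (ns (φ n)) : Measure ℝ) := by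
      simp_rw [hsq]; exact hν _ ht₂
    have hle (n) : ∫ x, Real.exp (t * x) ^ 2 ∂(ν (ns (φ n)) : Measure ℝ) ≤ D := by
      simp_rw [hsq]; exact hD _
    refine ⟨((memLp_two_iff_integrable_sq hcont.aestronglyMeasurable).2
      (integrable_sq_of_tendsto_probabilityMeasure hlim hcont hint hle).1).integrable
        one_le_two, ?_⟩
    exact tendsto_nhds_unique
      (tendsto_integral_of_integral_sq_le hlim hcont (fun x ↦ (Real.exp_pos _).le) hint hle)
      ((h t ht₁).comp hsub)
  refine Subtype.ext (ext_of_mgf_eqOn (ν := (ν' : Measure ℝ)) (ν' := (ν₀ : Measure ℝ)) (half_pos hδ) (fun t ht ↦ (moment ht).1) (fun t ht ↦ ?_)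
    fun t ht ↦ (moment ht).2)
  exact hν₀ ⟨by linarith [ht.1], by linarith [ht.2]⟩

lemma mgf_id_gammaMeasure {a r t : ℝ} (ha : 0 < a) (hr : 0 < r) (ht : t < r) :
    mgf id (gammaMeasure a r) t = (r / (r - t)) ^ a := by
  have hrt : 0 < r - t := sub_pos.2 ht
  have hpdf : ∀ᵐ x ∂(volume : Measure ℝ), gammaPDF a r x < ⊤ :=
    ae_of_all _ fun x ↦ ENNReal.ofReal_lt_top
  have hmeas : Measurable (gammaPDF a r) := (measurable_gammaPDFReal a r).ennreal_ofReal
  have hzero : ∀ x ∉ Set.Ici (0 : ℝ),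
      (gammaPDF a r x).toReal • Real.exp (t * id x) = 0 := fun x hx ↦ by
    rw [gammaPDF_of_neg (not_le.1 hx)]; simp
  rw [mgf, gammaMeasure, integral_withDensity_eq_integral_toReal_smul hmeas hpdf,
    ← setIntegral_eq_integral_of_forall_compl_eq_zero hzero, integral_Ici_eq_integral_Ioi]
  calc ∫ x in Set.Ioi 0, (gammaPDF a r x).toReal • Real.exp (t * id x)
      = ∫ x in Set.Ioi 0,
          r ^ a / Real.Gamma a * (x ^ (a - 1) * Real.exp (-((r - t) * x))) := by
        refine setIntegral_congr_fun measurableSet_Ioi fun x (hx : 0 < x) ↦ ?_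
        have hΓ := Real.Gamma_pos_of_pos ha
        simp only [id, smul_eq_mul]
        rw [gammaPDF_of_nonneg hx.le, ENNReal.toReal_ofReal (by positivity), mul_assoc, mul_assoc,
          ← Real.exp_add]
        ring_nf
    _ = (r / (r - t)) ^ a := by
        rw [integral_const_mul, Real.integral_rpow_mul_exp_neg_mul_Ioi ha hrt,
          Real.div_rpow zero_le_one hrt.le, Real.div_rpow hr.le hrt.le, Real.one_rpow]
        have := (Real.Gamma_pos_of_pos ha).ne'
        field_simp

lemma mem_integrableExpSet_gammaMeasure {a r t : ℝ} (ha : 0 < a) (hr : 0 < r) (ht : t < r) :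
    t ∈ integrableExpSet id (gammaMeasure a r) := by
  by_contra h
  have h_zero : mgf id (gammaMeasure a r) t = 0 := integral_undef h
  rw [mgf_id_gammaMeasure ha hr ht] at h_zero
  exact (Real.rpow_pos_of_pos (div_pos hr (sub_pos.2 ht)) a).ne' h_zero

/-- Moment convergence implies convergence in distribution: if `Wₘ > 0` a.s. and for every
`γ > -1` the moments `E[Wₘ^γ]` converge to `(1+γ)^{-(k-1)/2}`, then the laws of
`-2 log Wₘ` converge weakly (i.e. integrals of every bounded continuous function converge)
to the chi-squared distribution with `k-1` degrees of freedom. -/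
theorem stmt_14 {Ω : Type*} [MeasurableSpace Ω] (μ : Measure Ω) [IsProbabilityMeasure μ]
    (k : ℕ) (hk : 2 ≤ k) (W : ℕ → Ω → ℝ) (hmeas : ∀ m, Measurable (W m))
    (hpos : ∀ m, ∀ᵐ ω ∂μ, 0 < W m ω)
    (hint : ∀ γ : ℝ, -1 < γ → ∀ m, Integrable (fun ω => W m ω ^ γ) μ)
    (hmom : ∀ γ : ℝ, -1 < γ →
      Tendsto (fun m => ∫ ω, W m ω ^ γ ∂μ) atTop
        (𝓝 ((1 + γ) ^ (-(((k : ℝ) - 1) / 2))))) :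
    ∀ f : ℝ →ᵇ ℝ,
      Tendsto
        (fun m => ∫ y, f y ∂(Measure.map (fun ω => -2 * Real.log (W m ω)) μ)) atTop
        (𝓝 (∫ y, f y ∂(gammaMeasure (((k : ℝ) - 1) / 2) (1 / 2)))) := by
  have hk' : (0 : ℝ) < ((k : ℝ) - 1) / 2 := by
    have : (2 : ℝ) ≤ k := by exact_mod_cast hk
    linarith
  have hY (m) : Measurable fun ω ↦ -2 * Real.log (W m ω) := (hmeas m).log.const_mul (-2)
  have hprob := isProbabilityMeasure_gammaMeasure hk' one_half_pos
  have hexp (t : ℝ) (m) :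
      (fun ω ↦ Real.exp (t * (-2 * Real.log (W m ω)))) =ᵐ[μ] fun ω ↦ W m ω ^ (-2 * t) := by
    filter_upwards [hpos m] with ω hω
    rw [Real.rpow_def_of_pos hω]
    ring_nf
  let ν (m : ℕ) : ProbabilityMeasure ℝ :=
    ⟨μ.map fun ω ↦ -2 * Real.log (W m ω), Measure.isProbabilityMeasure_map (hY m).aemeasurable⟩
  let ν₀ : ProbabilityMeasure ℝ := ⟨gammaMeasure (((k : ℝ) - 1) / 2) (1 / 2), hprob⟩
  have hlim : Tendsto ν atTop (𝓝 ν₀) := by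
    refine tendsto_of_tendsto_mgf one_half_pos (fun m t ht ↦ ?_)
      (fun t ht ↦ mem_integrableExpSet_gammaMeasure hk' one_half_pos ht.2) fun t ht ↦ ?_
    · refine (integrable_map_measure (by fun_prop) (hY m).aemeasurable).2 ?_
      exact (hint (-2 * t) (by linarith [ht.2]) m).congr (hexp t m).symm
    · have hpos' : 0 < 1 + -2 * t := by linarith [ht.2]
      have hν₀ : mgf id (ν₀ : Measure ℝ) t = (1 + -2 * t) ^ (-(((k : ℝ) - 1) / 2)) := by
        refine (mgf_id_gammaMeasure hk' one_half_pos ht.2).trans ?_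
        rw [Real.rpow_neg hpos'.le, ← Real.inv_rpow hpos'.le]
        congr 1
        rw [← one_div, div_eq_div_iff (by linarith [ht.2]) hpos'.ne']
        ring
      rw [hν₀]
      refine (hmom (-2 * t) (by linarith)).congr fun m ↦ ?_
      rw [← integral_congr_ae (hexp t m)]
      exact (integral_map (hY m).aemeasurable (f := fun x ↦ Real.exp (t * x)) (by fun_prop)).symm
  exact ProbabilityMeasure.tendsto_iff_forall_integral_tendsto.1 hlim
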